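/- arXiv:1603.07168 — 6 statements merged into one kernel-verified Lean document; each statement's English description precedes it below -/
import Mathlib

section
/- Let G = (A ∪ B, E) be a bipartite graph where each applicant has a strict preference list and each post puts all its neighbors into a single tie. Then G admits a popular matching if and only if there exist a matching M of G and a partition ⟨P1,P2,P3⟩ of B such that (M, ⟨P1,P2,P3⟩) is well-structured. -/
open Classical

noncomputable section

variable {A B : Type*}

/-- A matching in the bipartite graph `G = (A ∪ B, E)`, represented as a partial
function assigning to each applicant `a ∈ A` its partner post (if any). -/
def IsMatching (E : A → B → Prop) (M : A → Option B) : Prop :=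
  (∀ a b, M a = some b → E a b) ∧ ∀ a a' b, M a = some b → M a' = some b → a = a'

/-- Post `b` is matched in `M`. -/
def PostMatched (M : A → Option B) (b : B) : Prop := ∃ a, M a = some b

/-- Applicant `a` prefers matching `M` to `M'` (lower rank = more preferred);
an applicant prefers being matched to being unmatched. -/
def APrefers (rank : A → B → ℕ) (M M' : A → Option B) (a : A) : Prop :=
  match M a, M' a with
  | some _, none => True
  | some b, some b' => rank a b < rank a b'
  | none, _ => False

/-- In the model where each post puts all its neighbors into a single tie,
post `b` prefers `M` to `M'` iff it is matched in `M` and unmatched in `M'`. -/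
def BPrefers (M M' : A → Option B) (b : B) : Prop :=
  PostMatched M b ∧ ¬ PostMatched M' b

/-- `phi rank M M'` is the number of vertices preferring `M` to `M'`
(both sides vote; posts have all neighbors in a single tie). -/
def phi (rank : A → B → ℕ) (M M' : A → Option B) : ℕ :=
  Nat.card {a : A // APrefers rank M M' a} + Nat.card {b : B // BPrefers M M' b}

/-- `M` is a popular matching of `G` (two-sided votes, one-sided ties model). -/
def Popular (E : A → B → Prop) (rank : A → B → ℕ) (M : A → Option B) : Prop :=
  IsMatching E M ∧ ∀ M', IsMatching E M' → phi rank M' M ≤ phi rank M M'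

/-- The applicants' preference lists are strict: distinct neighbors get distinct ranks. -/
def StrictRanks (E : A → B → Prop) (rank : A → B → ℕ) : Prop :=
  ∀ a b b', E a b → E a b' → rank a b = rank a b' → b = b'

/-- `f a` is applicant `a`'s top-ranked neighbor. -/
def IsTopChoice (E : A → B → Prop) (rank : A → B → ℕ) (f : A → B) : Prop :=
  ∀ a, E a (f a) ∧ ∀ b, E a b → rank a (f a) ≤ rank a b

/-- `rVal E rank F a` is the rank of `a`'s most preferred neighbor outside the
set `F` of top posts, and `⊤` (infinity) if all of `a`'s neighbors lie in `F`. -/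
def rVal (E : A → B → Prop) (rank : A → B → ℕ) (F : Set B) (a : A) : ℕ∞ :=
  sInf {x : ℕ∞ | ∃ b, E a b ∧ b ∉ F ∧ x = (rank a b : ℕ∞)}

/-- A matching `M` together with a partition `⟨P1, P2, P3⟩` of the posts `B` is
well-structured. Here `Set.range f` is the set `F` of top posts. -/
structure WellStructured (E : A → B → Prop) (rank : A → B → ℕ) (f : A → B)
    (M : A → Option B) (P1 P2 P3 : Set B) : Prop where
  union_eq : P1 ∪ P2 ∪ P3 = Set.univ
  disj12 : Disjoint P1 P2
  disj13 : Disjoint P1 P3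
  disj23 : Disjoint P2 P3
  P1_subset_F : P1 ⊆ Set.range f
  P3_disjoint_F : Disjoint P3 (Set.range f)
  matched_P12 : ∀ b ∈ P1 ∪ P2, PostMatched M b
  unmatched_nbrs : ∀ a, M a = none → ∀ b, E a b → b ∈ P1
  pair_P1 : ∀ a b, M a = some b → b ∈ P1 → b = f a ∧ ∀ b', E a b' → b' ∉ P3
  pair_P2 : ∀ a b, M a = some b → b ∈ P2 →
    (∀ b', E a b' → b' ∈ P2 → rank a b ≤ rank a b') ∧
      (rank a b : ℕ∞) ≤ rVal E rank (Set.range f) a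
  pair_P3 : ∀ a b, M a = some b → b ∈ P3 →
    ∀ b', E a b' → b' ∈ P3 → rank a b ≤ rank a b'

section Potentials

variable {V : Type*}

/-- The weight of a walk, listed from its last vertex back to its first. -/
def walkWeight (w : V → V → ℤ) : List V → ℤ
  | [] => 0
  | [_] => 0
  | u :: v :: l => w v u + walkWeight w (v :: l)

lemma walkWeight_append (w : V → V → ℤ) (c : List V) (u : V) (l : List V) :
    walkWeight w (c ++ u :: l) = walkWeight w (c ++ [u]) + walkWeight w (u :: l) := by
  induction c with
  | nil => simp [walkWeight]
  | cons x c ih =>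
    cases c with
    | nil => simp [walkWeight]
    | cons y c =>
      simp only [List.cons_append, walkWeight] at ih ⊢
      rw [ih]; ring

/-- A simple walk closes up to a cyclic permutation. -/
lemma exists_perm_of_nodup [Fintype V] (w : V → V → ℤ) (hw : ∀ v, w v v = 0) (l : List V) :
    ∀ y : V, (y :: l).Nodup → ∃ σ : Equiv.Perm V, (∀ z, z ∉ y :: l → σ z = z) ∧
      σ ((y :: l).getLast (List.cons_ne_nil y l)) = y ∧
      ∑ z, w (σ z) z =
        w y ((y :: l).getLast (List.cons_ne_nil y l)) + walkWeight w (y :: l) := by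
  induction l with
  | nil =>
    intro y _
    exact ⟨1, by simp, by simp, by simp [hw, walkWeight]⟩
  | cons y t ih =>
    intro x hx
    obtain ⟨σ, hfix, hlast, hsum⟩ := ih y (List.nodup_cons.mp hx).2
    have hxt : x ∉ y :: t := (List.nodup_cons.mp hx).1
    rw [List.getLast_cons (List.cons_ne_nil y t)]
    set u := (y :: t).getLast (List.cons_ne_nil y t) with hu
    have hut : u ∈ y :: t := List.getLast_mem _
    have hxu : u ≠ x := fun h => hxt (h ▸ hut)
    have hσx : σ x = x := hfix x hxt
    refine ⟨Equiv.swap x y * σ, ?_, ?_, ?_⟩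
    · intro z hz
      have hz' : z ≠ x ∧ z ∉ y :: t := by simpa using hz
      have hzy : z ≠ y := fun h => hz'.2 (by simp [h])
      rw [Equiv.Perm.mul_apply, hfix z hz'.2, Equiv.swap_apply_of_ne_of_ne hz'.1 hzy]
    · rw [Equiv.Perm.mul_apply, hlast, Equiv.swap_apply_right]
    · have hdiff : ∑ z, (w ((Equiv.swap x y * σ) z) z - w (σ z) z) =
          (w x u - w y u) + (w y x - w x x) := by
        rw [Fintype.sum_eq_add u x hxu]
        · simp [Equiv.Perm.mul_apply, hlast, hσx]
        · rintro z ⟨hzu, hzx⟩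
          have h1 : σ z ≠ y := fun h => hzu (σ.injective (h.trans hlast.symm))
          have h2 : σ z ≠ x := fun h => hzx (σ.injective (h.trans hσx.symm))
          rw [Equiv.Perm.mul_apply, Equiv.swap_apply_of_ne_of_ne h2 h1, sub_self]
      rw [Finset.sum_sub_distrib, hsum, hw x] at hdiff
      simp only [walkWeight]
      linarith

/-- If no permutation has positive weight, then the arc weights admit an integral potential. -/
lemma exists_potential [Fintype V] (w : V → V → ℤ) (hw : ∀ v, w v v = 0)
    (hσ : ∀ σ : Equiv.Perm V, ∑ v, w v (σ v) ≤ 0) :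
    ∃ p : V → ℤ, ∀ v u, p v + w v u ≤ p u := by
  have hfin : {l : List V | l.Nodup}.Finite :=
    (List.finite_length_le V (Fintype.card V)).subset fun l hl => List.Nodup.length_le_card hl
  have hmax : ∀ u, ∃ l : List V, (u :: l).Nodup ∧
      ∀ l', (u :: l').Nodup → walkWeight w (u :: l') ≤ walkWeight w (u :: l) := by
    intro u
    have hf : {l : List V | (u :: l).Nodup}.Finite :=
      hfin.subset fun l hl => (List.nodup_cons.mp hl).2
    obtain ⟨l, hl, hl'⟩ := Set.exists_max_image _ (fun l => walkWeight w (u :: l)) hf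
      ⟨[], by simp⟩
    exact ⟨l, hl, hl'⟩
  choose P hP hPmax using hmax
  refine ⟨fun u => walkWeight w (u :: P u), fun v u => ?_⟩
  by_cases hu : u ∈ v :: P v
  · obtain ⟨c, l, hcl⟩ := List.append_of_mem hu
    have hnd := hP v
    rw [hcl] at hnd
    have hle := hPmax u l hnd.of_append_right
    have hnd' : (c ++ [u]).Nodup := by
      have : c ++ u :: l = (c ++ [u]) ++ l := by simp
      rw [this] at hnd
      exact hnd.of_append_left
    obtain ⟨t, ht⟩ : ∃ t, c ++ [u] = v :: t := by
      cases c with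
      | nil => simp at hcl; exact ⟨[], by simp [hcl.1]⟩
      | cons x c => simp at hcl; exact ⟨c ++ [u], by simp [hcl.1]⟩
    obtain ⟨σ, -, -, hsum⟩ := exists_perm_of_nodup w hw t v (ht ▸ hnd')
    have hlast : (v :: t).getLast (List.cons_ne_nil v t) = u := by simp [← ht]
    have hcyc := hσ σ⁻¹
    rw [← Equiv.sum_comp σ] at hcyc
    simp only [Equiv.Perm.inv_def, Equiv.symm_apply_apply] at hcyc
    rw [hsum, hlast, ← ht] at hcyc
    simp only [hcl]
    rw [walkWeight_append]
    linarith
  · have h := hPmax u (v :: P v) (List.nodup_cons.mpr ⟨hu, hP v⟩)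
    rw [walkWeight] at h
    linarith

/-- Integral duality for the assignment problem. -/
lemma exists_dual {L R : Type*} [Fintype L] (w : L → R → ℤ) (e₀ : L ≃ R)
    (hw : ∀ l, w l (e₀ l) = 0) (he : ∀ e : L ≃ R, ∑ l, w l (e l) ≤ 0) :
    ∃ (α : L → ℤ) (β : R → ℤ), (∀ l r, w l r ≤ α l + β r) ∧ ∀ l, α l + β (e₀ l) = 0 := by
  obtain ⟨p, hp⟩ := exists_potential (fun v u => w v (e₀ u)) hw
    fun σ => he (σ.trans e₀)
  refine ⟨fun l => -p l, fun r => p (e₀.symm r), fun l r => ?_, by simp⟩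
  have := hp l (e₀.symm r)
  simp only [Equiv.apply_symm_apply] at this
  linarith

end Potentials

/-- The vote of applicant `a` for partner `x` against partner `y`. -/
def aVote (rank : A → B → ℕ) (a : A) (x y : Option B) : ℤ :=
  (if APrefers rank (fun _ => x) (fun _ => y) a then 1 else 0) -
    (if APrefers rank (fun _ => y) (fun _ => x) a then 1 else 0)

/-- The vote of a post between being matched iff `p` and being matched iff `q`. -/
def bVote (p q : Prop) : ℤ :=
  (if p ∧ ¬ q then 1 else 0) - (if q ∧ ¬ p then 1 else 0)

lemma natCard_subtype_eq_sum {T : Type*} [Fintype T] (p : T → Prop) :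
    (Nat.card {x // p x} : ℤ) = ∑ x, if p x then 1 else 0 := by
  rw [Nat.card_eq_fintype_card, Fintype.card_subtype, Finset.sum_boole]

lemma phi_sub_phi [Fintype A] [Fintype B] (rank : A → B → ℕ) (M M' : A → Option B) :
    (phi rank M' M : ℤ) - phi rank M M' =
      ∑ a, aVote rank a (M' a) (M a) + ∑ b, bVote (PostMatched M' b) (PostMatched M b) := by
  simp only [phi, Nat.cast_add, natCard_subtype_eq_sum, aVote, bVote, Finset.sum_sub_distrib]
  refine (add_sub_add_comm (_ : ℤ) _ _ _).trans ?_
  refine congrArg₂ (· + ·) rfl (congrArg₂ (· - ·) ?_ ?_) <;>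
    exact Finset.sum_congr rfl fun _ _ => if_congr Iff.rfl rfl rfl

section Assignment

variable (E : A → B → Prop) (rank : A → B → ℕ) (M : A → Option B)

/-- The applicants' share of the weight in the assignment problem in which every applicant and
every post gets a private dummy partner; a non-edge leaves both its ends unmatched. -/
def rowVote : A ⊕ B → B ⊕ A → ℤ
  | .inl a, .inl b => aVote rank a (if E a b then some b else none) (M a)
  | .inl a, .inr _ => aVote rank a none (M a)
  | .inr _, _ => 0

/-- The posts' share of the weight in the assignment problem. -/
def colVote : B ⊕ A → A ⊕ B → ℤ
  | .inl b, .inl a => bVote (E a b) (PostMatched M b)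
  | .inl b, .inr _ => bVote False (PostMatched M b)
  | .inr _, _ => 0

/-- The matching induced by an assignment. -/
def assignedMatching (e : A ⊕ B ≃ B ⊕ A) (a : A) : Option B :=
  match e (.inl a) with
  | .inl b => if E a b then some b else none
  | .inr _ => none

variable {E}

lemma assignedMatching_eq_some {e : A ⊕ B ≃ B ⊕ A} {a : A} {b : B} :
    assignedMatching E e a = some b ↔ e (.inl a) = .inl b ∧ E a b := by
  unfold assignedMatching
  rcases e (.inl a) with c | c
  · by_cases h : E a c
    · simp only [h, if_true, Option.some.injEq, Sum.inl.injEq]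
      exact ⟨fun hc => ⟨hc, hc ▸ h⟩, fun hc => hc.1⟩
    · simp only [h, if_false, Sum.inl.injEq]
      exact ⟨fun hc => by simp at hc, fun hc => absurd (hc.1 ▸ hc.2) h⟩
  · simp

lemma isMatching_assignedMatching (e : A ⊕ B ≃ B ⊕ A) :
    IsMatching E (assignedMatching E e) := by
  refine ⟨fun a b h => (assignedMatching_eq_some.mp h).2, fun a a' b h h' => ?_⟩
  exact Sum.inl_injective (e.injective
    ((assignedMatching_eq_some.mp h).1.trans (assignedMatching_eq_some.mp h').1.symm))

lemma sum_weight [Fintype A] [Fintype B] (e : A ⊕ B ≃ B ⊕ A) :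
    ∑ l, (rowVote E rank M l (e l) + colVote E M (e l) l) =
      (phi rank (assignedMatching E e) M : ℤ) - phi rank M (assignedMatching E e) := by
  have hcol : ∑ l, colVote E M (e l) l = ∑ r, colVote E M r (e.symm r) := by
    rw [← Equiv.sum_comp e]
    simp
  rw [phi_sub_phi, Finset.sum_add_distrib, hcol, Fintype.sum_sum_type, Fintype.sum_sum_type]
  have h0 : ∑ b : B, rowVote E rank M (.inr b) (e (.inr b)) = 0 := by simp [rowVote]
  have h1 : ∑ a : A, colVote E M (.inr a) (e.symm (.inr a)) = 0 := by simp [colVote]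
  rw [h0, h1, add_zero, add_zero]
  congr 1
  · refine Finset.sum_congr rfl fun a _ => ?_
    unfold assignedMatching
    rcases e (.inl a) with c | c <;> rfl
  · refine Finset.sum_congr rfl fun b _ => ?_
    rcases h : e.symm (.inl b) with a | c
    · have : PostMatched (assignedMatching E e) b ↔ E a b := by
        simp only [PostMatched, assignedMatching_eq_some, ← Equiv.eq_symm_apply, h]
        simp
      simp only [colVote, this]
    · have : PostMatched (assignedMatching E e) b ↔ False := by
        simp only [PostMatched, assignedMatching_eq_some, ← Equiv.eq_symm_apply, h]
        simp
      simp only [colVote, this]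

/-- Every matching extends to an assignment in which each matched pair also pairs its dummies. -/
lemma exists_assignment [Fintype A] [Fintype B] (hM : IsMatching E M) :
    ∃ e : A ⊕ B ≃ B ⊕ A, (∀ a b, M a = some b → e (.inl a) = .inl b ∧ e (.inr b) = .inr a) ∧
      (∀ a, M a = none → e (.inl a) = .inr a) ∧
      ∀ b, ¬ PostMatched M b → e (.inr b) = .inl b := by
  let g : A ⊕ B → B ⊕ A := fun l => match l with
    | .inl a => match M a with
      | some b => .inl b
      | none => .inr a
    | .inr b => if h : PostMatched M b then .inr h.choose else .inl b
  have g1 : ∀ a b, M a = some b → g (.inl a) = .inl b := fun a b h => by simp [g, h]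
  have g2 : ∀ a b, M a = some b → g (.inr b) = .inr a := fun a b h => by
    have hb : PostMatched M b := ⟨a, h⟩
    simp only [g, hb, dif_pos]
    rw [hM.2 _ _ _ hb.choose_spec h]
  have g3 : ∀ a, M a = none → g (.inl a) = .inr a := fun a h => by simp [g, h]
  have g4 : ∀ b, ¬ PostMatched M b → g (.inr b) = .inl b := fun b h => by simp [g, h]
  have hsurj : Function.Surjective g := by
    rintro (b | a)
    · by_cases hb : PostMatched M b
      · exact ⟨.inl hb.choose, g1 _ _ hb.choose_spec⟩
      · exact ⟨.inr b, g4 b hb⟩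
    · cases h : M a with
      | none => exact ⟨.inl a, g3 a h⟩
      | some b => exact ⟨.inr b, g2 a b h⟩
  have hbij : Function.Bijective g :=
    (Fintype.bijective_iff_surjective_and_card g).mpr ⟨hsurj, by simp [add_comm]⟩
  exact ⟨Equiv.ofBijective g hbij, fun a b h => ⟨g1 a b h, g2 a b h⟩, g3, g4⟩

lemma assignedMatching_eq {e : A ⊕ B ≃ B ⊕ A} (hM : IsMatching E M)
    (h1 : ∀ a b, M a = some b → e (.inl a) = .inl b)
    (h2 : ∀ a, M a = none → e (.inl a) = .inr a) : assignedMatching E e = M := by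
  funext a
  cases h : M a with
  | none => simp [assignedMatching, h2 a h]
  | some b => exact assignedMatching_eq_some.mpr ⟨h1 a b h, hM.1 a b h⟩

end Assignment

@[simp] lemma aVote_self (rank : A → B → ℕ) (a : A) (x : Option B) : aVote rank a x x = 0 := by
  simp [aVote]

@[simp] lemma bVote_self (p : Prop) : bVote p p = 0 := by simp [bVote]

/-- A dual certificate for the popularity of the matching `M`. -/
structure DualCertificate (E : A → B → Prop) (rank : A → B → ℕ) (M : A → Option B)
    (α : A → ℤ) (β : B → ℤ) : Prop where
  edge : ∀ a b, E a b →
    aVote rank a (some b) (M a) + bVote True (PostMatched M b) ≤ α a + β b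
  applicant : ∀ a, aVote rank a none (M a) ≤ α a
  post : ∀ b, bVote False (PostMatched M b) ≤ β b
  matched : ∀ a b, M a = some b → α a + β b = 0
  applicant_unmatched : ∀ a, M a = none → α a = 0
  post_unmatched : ∀ b, ¬ PostMatched M b → β b = 0

lemma DualCertificate.popular [Fintype A] [Fintype B] {E : A → B → Prop} {rank : A → B → ℕ}
    {M : A → Option B} {α : A → ℤ} {β : B → ℤ} (h : DualCertificate E rank M α β)
    (hM : IsMatching E M) : Popular E rank M := by
  refine ⟨hM, fun M' hM' => ?_⟩
  obtain ⟨e, he1, he2, -⟩ := exists_assignment M' hM'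
  obtain ⟨e₀, h01, h02, h03⟩ := exists_assignment M hM
  have hsum := sum_weight (E := E) rank M e
  rw [assignedMatching_eq M' hM' (fun a b h => (he1 a b h).1) he2] at hsum
  let α' : A ⊕ B → ℤ := Sum.elim α 0
  let β' : B ⊕ A → ℤ := Sum.elim β 0
  have hle : ∑ l, (rowVote E rank M l (e l) + colVote E M (e l) l) ≤
      ∑ l, (α' l + β' (e l)) := by
    refine Finset.sum_le_sum fun l _ => ?_
    generalize e l = r
    rcases l with a | b' <;> rcases r with b | a'
    · by_cases hab : E a b
      · simpa [rowVote, colVote, α', β', hab] using h.edge a b hab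
      · simpa [rowVote, colVote, α', β', hab] using add_le_add (h.applicant a) (h.post b)
    · simpa [rowVote, colVote, α', β'] using h.applicant a
    · simpa [rowVote, colVote, α', β'] using h.post b
    · simp [rowVote, colVote, α', β']
  have hzero : ∑ l, (α' l + β' (e₀ l)) = 0 := by
    refine Finset.sum_eq_zero fun l _ => ?_
    rcases l with a | b
    · cases hMa : M a with
      | none => simp [h02 a hMa, α', β', h.applicant_unmatched a hMa]
      | some b => simp [(h01 a b hMa).1, α', β', h.matched a b hMa]
    · by_cases hb : PostMatched M b
      · obtain ⟨a, ha⟩ := hb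
        simp [(h01 a b ha).2, α', β']
      · simp [h03 b hb, α', β', h.post_unmatched b hb]
  rw [Finset.sum_add_distrib, Equiv.sum_comp] at hzero
  rw [hsum, Finset.sum_add_distrib, Equiv.sum_comp, hzero] at hle
  omega

lemma exists_int_between {S T : Type*} [Finite S] [Finite T] (g : S → ℤ) (k : T → ℤ)
    (h : ∀ s t, k t ≤ g s) : ∃ c, (∀ s, c ≤ g s) ∧ ∀ t, k t ≤ c := by
  rcases isEmpty_or_nonempty S with hS | hS
  · obtain ⟨c, hc⟩ := (Set.finite_range k).bddAbove
    exact ⟨c, fun s => hS.elim s, fun t => hc ⟨t, rfl⟩⟩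
  · obtain ⟨s, hs⟩ := Finite.exists_min g
    exact ⟨g s, hs, h s⟩

lemma Popular.exists_dualCertificate [Fintype A] [Fintype B] {E : A → B → Prop}
    {rank : A → B → ℕ} {M : A → Option B} (h : Popular E rank M) :
    ∃ α β, DualCertificate E rank M α β := by
  obtain ⟨hM, hpop⟩ := h
  obtain ⟨e₀, h01, h02, h03⟩ := exists_assignment M hM
  obtain ⟨α, β, hαβ, htight⟩ := exists_dual
    (fun l r => rowVote E rank M l r + colVote E M r l) e₀
    (by
      rintro (a | b)
      · cases hMa : M a with
        | none => simp [h02 a hMa, rowVote, colVote, hMa]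
        | some b =>
          have hb : PostMatched M b := ⟨a, hMa⟩
          simp [(h01 a b hMa).1, rowVote, colVote, hMa, hM.1 a b hMa, hb]
      · by_cases hb : PostMatched M b
        · obtain ⟨a, ha⟩ := hb
          simp [(h01 a b ha).2, rowVote, colVote]
        · simp [h03 b hb, rowVote, colVote, hb])
    (by
      intro e
      have hle := hpop _ (isMatching_assignedMatching (E := E) e)
      have := sum_weight (E := E) rank M e
      omega)
  obtain ⟨c, hc1, hc2⟩ := exists_int_between (fun a : A => β (.inr a))
    (fun b : B => -α (.inr b)) (fun a b => by
      have := hαβ (.inr b) (.inr a)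
      simp only [rowVote, colVote] at this
      linarith)
  have hα0 : ∀ a, M a = none → α (.inl a) + c ≤ 0 := fun a ha => by
    have := htight (.inl a)
    rw [h02 a ha] at this
    linarith [hc1 a]
  have hβ0 : ∀ b, ¬ PostMatched M b → β (.inl b) - c ≤ 0 := fun b hb => by
    have := htight (.inr b)
    rw [h03 b hb] at this
    linarith [hc2 b]
  have hpair : ∀ a b, M a = some b → β (.inr a) = c ∧ α (.inr b) = -c := fun a b hab => by
    have := htight (.inr b)
    rw [(h01 a b hab).2] at this
    have h1 := hc1 a
    have h2 := hc2 b
    constructor <;> linarith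
  let α' : A → ℤ := fun a => if M a = none then 0 else α (.inl a) + c
  let β' : B → ℤ := fun b => if PostMatched M b then β (.inl b) - c else 0
  have hα' : ∀ a, α (.inl a) + c ≤ α' a := fun a => by
    by_cases ha : M a = none
    · simpa [α', ha] using hα0 a ha
    · simp [α', ha]
  have hβ' : ∀ b, β (.inl b) - c ≤ β' b := fun b => by
    by_cases hb : PostMatched M b
    · simp [β', hb]
    · simpa [β', hb] using hβ0 b hb
  refine ⟨α', β', fun a b hab => ?_, fun a => ?_, fun b => ?_, fun a b hab => ?_,
    fun a ha => by simp [α', ha], fun b hb => by simp [β', hb]⟩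
  · have := hαβ (.inl a) (.inl b)
    simp only [rowVote, colVote, hab, if_true] at this
    linarith [hα' a, hβ' b]
  · cases ha : M a with
    | none => simp [α', ha]
    | some b =>
      have := hαβ (.inl a) (.inr a)
      simp only [rowVote, colVote, ha, (hpair a b ha).1] at this
      linarith [hα' a]
  · by_cases hb : PostMatched M b
    · obtain ⟨a, ha⟩ := hb
      have := hαβ (.inr b) (.inl b)
      simp only [rowVote, colVote, (hpair a b ha).2] at this
      linarith [hβ' b]
    · simp [β', hb]
  · have hb : PostMatched M b := ⟨a, hab⟩
    have := htight (.inl a)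
    rw [(h01 a b hab).1] at this
    simp only [α', β', hab, hb, if_true, reduceCtorEq, if_false]
    linarith

@[simp] lemma aVote_some_none (rank : A → B → ℕ) (a : A) (b : B) :
    aVote rank a (some b) none = 1 := by
  simp [aVote, APrefers]

@[simp] lemma aVote_none_some (rank : A → B → ℕ) (a : A) (b : B) :
    aVote rank a none (some b) = -1 := by
  simp [aVote, APrefers]

lemma aVote_some_some (rank : A → B → ℕ) (a : A) (b b' : B) :
    aVote rank a (some b) (some b') =
      if rank a b < rank a b' then 1 else if rank a b' < rank a b then -1 else 0 := by
  simp only [aVote, APrefers]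
  split_ifs <;> omega

lemma bVote_true (q : Prop) : bVote True q = if q then 0 else 1 := by
  by_cases h : q <;> simp [bVote, h]

lemma bVote_false (q : Prop) : bVote False q = if q then -1 else 0 := by
  by_cases h : q <;> simp [bVote, h]

lemma IsTopChoice.rank_lt {E : A → B → Prop} {rank : A → B → ℕ} {f : A → B}
    (htop : IsTopChoice E rank f) (hstrict : StrictRanks E rank) {a : A} {b : B}
    (hab : E a b) (hne : b ≠ f a) : rank a (f a) < rank a b :=
  lt_of_le_of_ne ((htop a).2 b hab) fun h => hne (hstrict a _ _ hab (htop a).1 h.symm)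

lemma WellStructured.exists_dualCertificate {E : A → B → Prop} {rank : A → B → ℕ} {f : A → B}
    {M : A → Option B} {P1 P2 P3 : Set B} (hstrict : StrictRanks E rank)
    (htop : IsTopChoice E rank f) (hM : IsMatching E M)
    (h : WellStructured E rank f M P1 P2 P3) : ∃ α β, DualCertificate E rank M α β := by
  have h3 : ∀ b, b ∉ P1 → b ∉ P2 → b ∈ P3 := fun b h1 h2 => by
    have : b ∈ P1 ∪ P2 ∪ P3 := h.union_eq ▸ Set.mem_univ b
    simpa [h1, h2] using this
  have hm1 : ∀ b ∈ P1, PostMatched M b := fun b hb => h.matched_P12 b (Or.inl hb)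
  have hm2 : ∀ b ∈ P2, PostMatched M b := fun b hb => h.matched_P12 b (Or.inr hb)
  have h12 : ∀ b ∈ P2, b ∉ P1 := fun b hb hb' => Set.disjoint_left.mp h.disj12 hb' hb
  let γ : B → ℤ := fun b => if b ∈ P1 then 1 else if b ∈ P2 then 0 else -1
  have hγ1 : ∀ b ∈ P1, γ b = 1 := fun b hb => by simp [γ, hb]
  have hγ2 : ∀ b ∈ P2, γ b = 0 := fun b hb => by simp [γ, hb, h12 b hb]
  have hγ3 : ∀ b, b ∉ P1 → b ∉ P2 → γ b = -1 := fun b hb hb' => by simp [γ, hb, hb']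
  have hγ : ∀ b, -1 ≤ γ b ∧ γ b ≤ 1 := fun b => by
    simp only [γ]; split_ifs <;> omega
  let β : B → ℤ := fun b => if PostMatched M b then γ b else 0
  refine ⟨fun a => (M a).elim 0 fun b => -γ b, β, fun a b hab => ?_, fun a => ?_, fun b => ?_,
    fun a b hab => ?_, fun a ha => by simp [ha], fun b hb => by simp [β, hb]⟩
  · rw [bVote_true]
    cases hMa : M a with
    | none =>
      have hb := h.unmatched_nbrs a hMa b hab
      simp [β, hm1 b hb, hγ1 b hb]
    | some c =>
      have hac := hM.1 a c hMa
      have hne : ¬ PostMatched M b → rank a c ≠ rank a b := fun hb hr =>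
        hb (hstrict a c b hac hab hr ▸ ⟨a, hMa⟩)
      simp only [aVote_some_some, Option.elim_some, β]
      by_cases hc1 : c ∈ P1
      · obtain ⟨rfl, hno⟩ := h.pair_P1 a c hMa hc1
        have htopb := (htop a).2 b hab
        rw [hγ1 _ hc1]
        by_cases hb1 : b ∈ P1
        · rw [hγ1 b hb1]
          simp only [hm1 b hb1, if_true]
          split_ifs <;> omega
        · have hb2 : b ∈ P2 := by
            by_contra hb2
            exact hno b hab (h3 b hb1 hb2)
          have := htop.rank_lt hstrict hab (fun hb => hb1 (hb ▸ hc1))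
          rw [hγ2 b hb2]
          simp only [hm2 b hb2, if_true]
          split_ifs <;> omega
      · by_cases hc2 : c ∈ P2
        · obtain ⟨hbest, hr⟩ := h.pair_P2 a c hMa hc2
          rw [hγ2 c hc2]
          by_cases hb1 : b ∈ P1
          · rw [hγ1 b hb1]
            simp only [hm1 b hb1, if_true]
            split_ifs <;> omega
          · by_cases hb2 : b ∈ P2
            · have := hbest b hab hb2
              rw [hγ2 b hb2]
              simp only [hm2 b hb2, if_true]
              split_ifs <;> omega
            · have hbF : b ∉ Set.range f := Set.disjoint_left.mp h.P3_disjoint_F (h3 b hb1 hb2)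
              have hle : rank a c ≤ rank a b := by
                have h' : rVal E rank (Set.range f) a ≤ (rank a b : ℕ∞) :=
                  sInf_le ⟨b, hab, hbF, rfl⟩
                exact_mod_cast hr.trans h'
              have hcb : rank a c ≠ rank a b := fun hr' =>
                hb2 (hstrict a c b hac hab hr' ▸ hc2)
              rw [hγ3 b hb1 hb2]
              split_ifs <;> omega
        · rw [hγ3 c hc1 hc2]
          by_cases hb : b ∈ P1 ∨ b ∈ P2
          · have hbm := h.matched_P12 b hb
            have : 0 ≤ γ b := by
              rcases hb with hb | hb
              · simp [hγ1 b hb]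
              · simp [hγ2 b hb]
            simp only [hbm, if_true]
            split_ifs <;> omega
          · rw [not_or] at hb
            have := h.pair_P3 a c hMa (h3 c hc1 hc2) b hab (h3 b hb.1 hb.2)
            rw [hγ3 b hb.1 hb.2]
            by_cases hbm : PostMatched M b
            · simp only [hbm, if_true]
              split_ifs <;> omega
            · have := hne hbm
              simp only [hbm, if_false]
              split_ifs <;> omega
  · cases hMa : M a with
    | none => simp
    | some c =>
      have := hγ c
      simp only [aVote_none_some, Option.elim_some]
      omega
  · have := hγ b
    simp only [bVote_false, β]
    split_ifs <;> omega
  · have hb : PostMatched M b := ⟨a, hab⟩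
    simp [hab, β, hb]

lemma DualCertificate.exists_wellStructured {E : A → B → Prop} {rank : A → B → ℕ} {f : A → B}
    {M : A → Option B} {α : A → ℤ} {β : B → ℤ} (h : DualCertificate E rank M α β)
    (hstrict : StrictRanks E rank) (htop : IsTopChoice E rank f) (hM : IsMatching E M) :
    ∃ P1 P2 P3 : Set B, WellStructured E rank f M P1 P2 P3 := by
  have hα : ∀ a b, M a = some b → -1 ≤ α a := fun a b hab => by
    simpa [hab] using h.applicant a
  have hβ : ∀ b, -1 ≤ β b ∧ β b ≤ 1 := fun b => by
    by_cases hb : PostMatched M b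
    · obtain ⟨a, ha⟩ := hb
      have h1 := h.post b
      have h2 := h.matched a b ha
      have h3 := hα a b ha
      rw [bVote_false] at h1
      split_ifs at h1 <;> constructor <;> omega
    · simp [h.post_unmatched b hb]
  have hα1 : ∀ a, α a ≤ 1 := fun a => by
    cases ha : M a with
    | none => simp [h.applicant_unmatched a ha]
    | some b =>
      have := h.matched a b ha
      have := hβ b
      omega
  have hedge_m : ∀ a b, E a b → PostMatched M b →
      aVote rank a (some b) (M a) ≤ α a + β b := fun a b hab hb => by
    simpa [bVote_true, hb] using h.edge a b hab
  have hedge_u : ∀ a b, E a b → ¬ PostMatched M b →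
      aVote rank a (some b) (M a) + 1 ≤ α a := fun a b hab hb => by
    simpa [bVote_true, hb, h.post_unmatched b hb] using h.edge a b hab
  have hvote : ∀ a, M a ≠ some (f a) → aVote rank a (some (f a)) (M a) = 1 := fun a ha => by
    cases hMa : M a with
    | none => simp
    | some b =>
      have := htop.rank_lt hstrict (hM.1 a b hMa) (fun hb => ha (hb ▸ hMa))
      simp [aVote_some_some, this]
  have hF : ∀ a, PostMatched M (f a) := fun a => by
    by_contra hb
    have h1 := hedge_u a (f a) (htop a).1 hb
    rw [hvote a fun ha => hb ⟨a, ha⟩] at h1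
    have := hα1 a
    omega
  have hFneg : ∀ a, β (f a) = -1 → M a = some (f a) := fun a hb => by
    by_contra ha
    have h1 := hedge_m a (f a) (htop a).1 (hF a)
    rw [hvote a ha] at h1
    have := hα1 a
    omega
  have hone : ∀ a b, M a = some b → β b = 1 → b = f a := fun a b hab hb => by
    by_contra hne
    have h1 := hedge_m a (f a) (htop a).1 (hF a)
    rw [hvote a fun ha => hne (Option.some_injective _ (hab.symm.trans ha))] at h1
    have := hβ (f a)
    have := h.matched a b hab
    omega
  have hone_matched : ∀ b, β b = 1 → PostMatched M b := fun b hb => by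
    by_contra hbm
    have := h.post_unmatched b hbm
    omega
  have hone_range : ∀ b, β b = 1 → b ∈ Set.range f := fun b hb => by
    obtain ⟨a, ha⟩ := hone_matched b hb
    exact ⟨a, (hone a b ha hb).symm⟩
  have hrank : ∀ a b b', M a = some b → aVote rank a (some b') (M a) ≤ 0 →
      rank a b ≤ rank a b' := fun a b b' hab hv => by
    rw [hab, aVote_some_some] at hv
    by_contra hlt
    simp [not_le.mp hlt] at hv
  have hvote_ge : ∀ a b b', M a = some b → -1 ≤ aVote rank a (some b') (M a) :=
    fun a b b' hab => by
      rw [hab, aVote_some_some]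
      split_ifs <;> omega
  let P1 : Set B := {b | β b = 1}
  let P2 : Set B := {b | PostMatched M b ∧ (β b = 0 ∨ b ∈ Set.range f ∧ β b = -1)}
  have hP3 : ∀ b, b ∈ (P1 ∪ P2)ᶜ → PostMatched M b → β b = -1 := fun b hb hbm => by
    have h1 : β b ≠ 1 := fun h1 => hb (Or.inl h1)
    have h0 : β b ≠ 0 := fun h0 => hb (Or.inr ⟨hbm, Or.inl h0⟩)
    have := hβ b
    omega
  have h12 : Disjoint P1 P2 := by
    refine Set.disjoint_left.mpr fun b h1 h2 => ?_
    have h1 : β b = 1 := h1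
    rcases h2.2 with h2 | h2 <;> omega
  refine ⟨P1, P2, (P1 ∪ P2)ᶜ, Set.union_compl_self _, h12,
    disjoint_compl_right.mono_left Set.subset_union_left,
    disjoint_compl_right.mono_left Set.subset_union_right, hone_range, ?_, ?_, ?_, ?_, ?_, ?_⟩
  · refine Set.disjoint_left.mpr ?_
    rintro _ hb ⟨a, rfl⟩
    exact hb (Or.inr ⟨hF a, Or.inr ⟨⟨a, rfl⟩, hP3 _ hb (hF a)⟩⟩)
  · rintro b (hb | hb)
    · exact hone_matched b hb
    · exact hb.1
  · intro a ha b hab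
    have h0 := h.applicant_unmatched a ha
    by_cases hb : PostMatched M b
    · have h1 := hedge_m a b hab hb
      rw [ha, aVote_some_none] at h1
      have := hβ b
      change β b = 1
      omega
    · have h1 := hedge_u a b hab hb
      rw [ha, aVote_some_none] at h1
      omega
  · intro a b hab hb
    have hb : β b = 1 := hb
    refine ⟨hone a b hab hb, fun b' hab' hb' => ?_⟩
    have h1 := h.matched a b hab
    have h2 := hvote_ge a b b' hab
    by_cases hbm : PostMatched M b'
    · have h3 := hedge_m a b' hab' hbm
      have := hP3 b' hb' hbm
      omega
    · have h3 := hedge_u a b' hab' hbm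
      omega
  · rintro a b hab ⟨hbm, hb | ⟨⟨a', rfl⟩, hb⟩⟩
    · have h1 := h.matched a b hab
      have hle : ∀ b', E a b' → β b' ≠ 1 → rank a b ≤ rank a b' := fun b' hab' hb' => by
        refine hrank a b b' hab ?_
        by_cases hbm' : PostMatched M b'
        · have h2 := hedge_m a b' hab' hbm'
          have := hβ b'
          omega
        · have h2 := hedge_u a b' hab' hbm'
          omega
      refine ⟨fun b' hab' hb' => hle b' hab' fun h1 => Set.disjoint_left.mp h12 h1 hb',
        le_sInf ?_⟩
      rintro _ ⟨b', hab', hb', rfl⟩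
      exact_mod_cast hle b' hab' fun h1 => hb' (hone_range b' h1)
    · obtain rfl := hM.2 _ _ _ hab (hFneg a' hb)
      refine ⟨fun b' hab' _ => (htop a).2 b' hab', le_sInf ?_⟩
      rintro _ ⟨b', hab', -, rfl⟩
      exact_mod_cast (htop a).2 b' hab'
  · intro a b hab hb b' hab' hb'
    have h0 := hP3 b hb ⟨a, hab⟩
    have h1 := h.matched a b hab
    refine hrank a b b' hab ?_
    by_cases hbm : PostMatched M b'
    · have h2 := hedge_m a b' hab' hbm
      have := hP3 b' hb' hbm
      omega
    · have h2 := hedge_u a b' hab' hbm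
      omega

/-- `G` admits a popular matching iff there are a matching `M` and a
partition `⟨P1, P2, P3⟩` of `B` such that `(M, ⟨P1, P2, P3⟩)` is well-structured. -/
theorem popular_iff_exists_wellStructured
    [Fintype A] [Fintype B]
    (E : A → B → Prop) (rank : A → B → ℕ) (f : A → B)
    (hstrict : StrictRanks E rank) (htop : IsTopChoice E rank f) :
    (∃ M, Popular E rank M) ↔
      ∃ (M : A → Option B) (P1 P2 P3 : Set B),
        IsMatching E M ∧ WellStructured E rank f M P1 P2 P3 := by
  constructor
  · rintro ⟨M, hM⟩
    obtain ⟨α, β, h⟩ := hM.exists_dualCertificate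
    obtain ⟨P1, P2, P3, hP⟩ := h.exists_wellStructured hstrict htop hM.1
    exact ⟨M, P1, P2, P3, hM.1, hP⟩
  · rintro ⟨M, P1, P2, P3, hM, hP⟩
    obtain ⟨α, β, h⟩ := hP.exists_dualCertificate hstrict htop hM
    exact ⟨M, h.popular hM⟩
end
end

section
/- Let G = (A ∪ B, E) be a bipartite graph where each applicant has a strict preference list and each post puts all its neighbors into a single tie. If a matching M of G together with a partition ⟨P1,P2,P3⟩ of B is well-structured, then M is a popular matching of G, i.e., φ(M,M') ≥ φ(M',M) for every matching M' of G. -/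
open Classical

noncomputable section

variable {A B : Type*}

/-- The difference of the indicator functions of two predicates. -/
def indicatorDiff {X : Type*} (p q : X → Prop) (x : X) : ℤ :=
  (if p x then 1 else 0) - (if q x then 1 else 0)

theorem natCard_sub_natCard_eq_sum {X : Type*} [Fintype X] (p q : X → Prop) :
    (Nat.card {x // p x} : ℤ) - Nat.card {x // q x} = ∑ x, indicatorDiff p q x := by
  simp [indicatorDiff, Finset.sum_sub_distrib, Nat.card_eq_fintype_card, Fintype.card_subtype]

/-- Summing a post weight over the matched applicants is summing it over the matched posts. -/
theorem sum_elim_eq_sum_ite {A B : Type*} [Fintype A] [Fintype B] {E : A → B → Prop}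
    {N : A → Option B} (hN : IsMatching E N) (g : B → ℤ) :
    ∑ a, (N a).elim 0 g = ∑ b, if PostMatched N b then g b else 0 := by
  have hleft (a : A) : (N a).elim 0 g = ∑ b, if N a = some b then g b else 0 := by
    cases N a <;> simp
  have hright (b : B) : (if PostMatched N b then g b else 0) =
      ∑ a, if N a = some b then g b else 0 := by
    split_ifs with h
    · obtain ⟨a, ha⟩ := h
      rw [Finset.sum_eq_single a]
      · simp [ha]
      · intro a' _ hne
        exact if_neg fun h => hne (hN.2 _ _ _ h ha)
      · simp
    · exact (Finset.sum_eq_zero fun a _ => if_neg fun ha => h ⟨a, ha⟩).symm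
  simp_rw [hleft, hright]
  exact Finset.sum_comm

/-- The dual value of a post certifying popularity: `1` on `P1`, `0` on `P2`, and `-1` on the
remaining matched posts. Unmatched posts get `0`, and an applicant gets the negative of the value
of its partner. -/
def postDual {A B : Type*} (M : A → Option B) (P1 P2 : Set B) (b : B) : ℤ :=
  if PostMatched M b then if b ∈ P1 then 1 else if b ∈ P2 then 0 else -1 else 0

theorem rVal_le {A B : Type*} {E : A → B → Prop} {rank : A → B → ℕ} {F : Set B} {a : A} {b : B}
    (hE : E a b) (hb : b ∉ F) : rVal E rank F a ≤ rank a b :=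
  sInf_le ⟨b, hE, hb, rfl⟩

/-- Feasibility of the dual values at an applicant, paired with its partner in `M'` if any. -/
theorem vote_le_dual {A B : Type*} {E : A → B → Prop} {rank : A → B → ℕ} {f : A → B}
    (hstrict : StrictRanks E rank) (htop : IsTopChoice E rank f)
    {M M' : A → Option B} (hM : IsMatching E M) (hM' : IsMatching E M')
    {P1 P2 P3 : Set B} (hws : WellStructured E rank f M P1 P2 P3) (a : A) :
    indicatorDiff (APrefers rank M' M) (APrefers rank M M') a +
      ((M' a).elim 0 fun b =>
        indicatorDiff (BPrefers M' M) (BPrefers M M') b - postDual M P1 P2 b) ≤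
      -(M a).elim 0 (postDual M P1 P2) := by
  have cover (b : B) : b ∈ P1 ∨ b ∈ P2 ∨ b ∈ P3 := by
    have : b ∈ P1 ∪ P2 ∪ P3 := hws.union_eq ▸ Set.mem_univ b
    simpa [or_assoc] using this
  have not12 (b : B) : b ∈ P1 → b ∉ P2 := fun h h' => Set.disjoint_left.1 hws.disj12 h h'
  have not13 (b : B) : b ∈ P1 → b ∉ P3 := fun h h' => Set.disjoint_left.1 hws.disj13 h h'
  have not23 (b : B) : b ∈ P2 → b ∉ P3 := fun h h' => Set.disjoint_left.1 hws.disj23 h h'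
  have matched1 (b : B) (h : b ∈ P1) : PostMatched M b := hws.matched_P12 b (Or.inl h)
  have matched2 (b : B) (h : b ∈ P2) : PostMatched M b := hws.matched_P12 b (Or.inr h)
  rcases hMa : M a with _ | c <;> rcases hMa' : M' a with _ | b
  · simp [indicatorDiff, APrefers, hMa, hMa']
  · have hb := hws.unmatched_nbrs a hMa b (hM'.1 a b hMa')
    simp [indicatorDiff, APrefers, BPrefers, postDual, hMa, hMa', hb, matched1 b hb]
    grind
  · simp only [indicatorDiff, APrefers, postDual, hMa, hMa', Option.elim]
    grind
  · have hEc := hM.1 a c hMa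
    have hEb := hM'.1 a b hMa'
    have hc : PostMatched M c := ⟨a, hMa⟩
    have hb' : PostMatched M' b := ⟨a, hMa'⟩
    have hs := hstrict a b c hEb hEc
    have ht := (htop a).2 b hEb
    have h1 := hws.pair_P1 a c hMa
    have h2 := hws.pair_P2 a c hMa
    have h3 := hws.pair_P3 a c hMa
    have hr : c ∈ P2 → b ∈ P3 → rank a c ≤ rank a b := fun hc2 hb3 => by
      exact_mod_cast (h2 hc2).2.trans
        (rVal_le hEb (Set.disjoint_left.1 hws.P3_disjoint_F hb3))
    have h2' : c ∈ P2 → b ∈ P2 → rank a c ≤ rank a b := fun h h' => (h2 h).1 b hEb h'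
    clear h2
    simp only [indicatorDiff, APrefers, BPrefers, postDual, hMa, hMa', Option.elim, hb', hc]
    grind

/-- If `(M, ⟨P1, P2, P3⟩)` is well-structured, then `M` is a popular
matching of `G`, i.e. `φ(M, M') ≥ φ(M', M)` for every matching `M'` of `G`. -/
theorem popular_of_wellStructured
    [Fintype A] [Fintype B]
    (E : A → B → Prop) (rank : A → B → ℕ) (f : A → B)
    (hstrict : StrictRanks E rank) (htop : IsTopChoice E rank f)
    (M : A → Option B) (hM : IsMatching E M)
    (P1 P2 P3 : Set B) (hws : WellStructured E rank f M P1 P2 P3) :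
    Popular E rank M := by
  refine ⟨hM, fun M' hM' => ?_⟩
  have hA := natCard_sub_natCard_eq_sum (APrefers rank M' M) (APrefers rank M M')
  have hB := natCard_sub_natCard_eq_sum (BPrefers M' M) (BPrefers M M')
  have hdual := sum_elim_eq_sum_ite hM (postDual M P1 P2)
  have hedge := sum_elim_eq_sum_ite hM' (fun b =>
    indicatorDiff (BPrefers M' M) (BPrefers M M') b - postDual M P1 P2 b)
  have h1 : ∑ b, (indicatorDiff (BPrefers M' M) (BPrefers M M') b - postDual M P1 P2 b) ≤
      ∑ b, if PostMatched M' b then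
        indicatorDiff (BPrefers M' M) (BPrefers M M') b - postDual M P1 P2 b else 0 := by
    refine Finset.sum_le_sum fun b _ => ?_
    unfold indicatorDiff postDual BPrefers
    grind
  have h2 : ∑ b, (if PostMatched M b then postDual M P1 P2 b else 0) =
      ∑ b, postDual M P1 P2 b := by
    refine Finset.sum_congr rfl fun b _ => ?_
    unfold postDual
    grind
  have h3 : ∑ a, (indicatorDiff (APrefers rank M' M) (APrefers rank M M') a +
      (M' a).elim 0 fun b =>
        indicatorDiff (BPrefers M' M) (BPrefers M M') b - postDual M P1 P2 b) ≤
      ∑ a, -(M a).elim 0 (postDual M P1 P2) :=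
    Finset.sum_le_sum fun a _ => vote_le_dual hstrict htop hM hM' hws a
  rw [Finset.sum_add_distrib, Finset.sum_neg_distrib] at h3
  rw [Finset.sum_sub_distrib] at h1
  unfold phi
  omega
end
end

section
/- Let G = (A ∪ B, E) be as above, let (M, ⟨P1,P2,P3⟩) be well-structured, extend M to the A-complete matching M̂ using dummy last-resort posts, and label all non-M̂ edges with the applicants' votes. Then for every matching M' of G, in every alternating cycle of M̂ ⊕ M' the number of edges labeled −1 is at least the number of edges labeled +1. -/
open Classical

noncomputable section

variable {A B : Type*}

/-- The label (the applicant's vote) of an edge `(a, b)` of `G` not belonging to the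
matching `M`: it is `+1` if `a` is unmatched in `M` (equivalently, matched to its
dummy last-resort post in the `A`-complete extension `M̂`) or prefers `b` to `M a`,
and `-1` otherwise. -/
def edgeLabel (rank : A → B → ℕ) (M : A → Option B) (a : A) (b : B) : ℤ :=
  match M a with
  | none => 1
  | some b' => if rank a b < rank a b' then 1 else -1

/-- The index of the part of `⟨P1, P2, P3⟩` containing a post. -/
def partIndex (P1 P2 : Set B) (b : B) : ℤ :=
  if b ∈ P1 then 1 else if b ∈ P2 then 2 else 3

theorem edgeLabel_eq_one_or_neg_one (rank : A → B → ℕ) (M : A → Option B) (a : A) (b : B) :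
    edgeLabel rank M a b = 1 ∨ edgeLabel rank M a b = -1 := by
  unfold edgeLabel
  split
  · exact Or.inl rfl
  · split_ifs <;> simp

/-- In a well-structured pair, the vote of a matched applicant for a neighbor `c` is at most the
increase of the part index from `c` to the applicant's partner. -/
theorem WellStructured.edgeLabel_le {E : A → B → Prop} {rank : A → B → ℕ} {f : A → B}
    {M : A → Option B} {P1 P2 P3 : Set B} (hws : WellStructured E rank f M P1 P2 P3)
    (htop : IsTopChoice E rank f) {a : A} {b c : B} (hab : M a = some b) (hac : E a c) :
    edgeLabel rank M a c ≤ partIndex P1 P2 b - partIndex P1 P2 c := by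
  have hcover : ∀ x, x ∉ P1 → x ∉ P2 → x ∈ P3 := fun x h1 h2 => by
    have hx : x ∈ P1 ∪ P2 ∪ P3 := hws.union_eq ▸ Set.mem_univ x
    simpa [h1, h2] using hx
  have hlabel : edgeLabel rank M a c = if rank a c < rank a b then 1 else -1 := by
    simp [edgeLabel, hab]
  rw [hlabel]
  unfold partIndex
  by_cases hb1 : b ∈ P1
  · obtain ⟨hbf, hno⟩ := hws.pair_P1 a b hab hb1
    have hle : rank a b ≤ rank a c := hbf ▸ (htop a).2 c hac
    have hc3 := hno c hac
    have hc := hcover c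
    grind
  by_cases hb2 : b ∈ P2
  · obtain ⟨hbest, hr⟩ := hws.pair_P2 a b hab hb2
    have hle : c ∉ P1 → rank a b ≤ rank a c := fun hc1 => by
      by_cases hc2 : c ∈ P2
      · exact hbest c hac hc2
      · have hcF : c ∉ Set.range f :=
          Set.disjoint_left.mp hws.P3_disjoint_F (hcover c hc1 hc2)
        have hrc : rVal E rank (Set.range f) a ≤ (rank a c : ℕ∞) :=
          sInf_le ⟨c, hac, hcF, rfl⟩
        exact_mod_cast hr.trans hrc
    grind
  · have hle : c ∉ P1 → c ∉ P2 → rank a b ≤ rank a c := fun hc1 hc2 =>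
      hws.pair_P3 a b hab (hcover b hb1 hb2) c hac (hcover c hc1 hc2)
    grind

/-- Let `(M, ⟨P1, P2, P3⟩)` be well-structured and let `M'` be any
matching of `G`. An alternating cycle of `M̂ ⊕ M'` is given by distinct applicants
`aseq 0, …, aseq (k-1)` and posts `bseq i` with `(aseq i, bseq i) ∈ M̂` and
`(aseq (i+1), bseq i) ∈ M'` (indices mod `k`). In any such cycle the number of
edges labeled `-1` is at least the number of edges labeled `+1`. -/
theorem alternating_cycle_labels
    [Fintype A] [Fintype B]
    (E : A → B → Prop) (rank : A → B → ℕ) (f : A → B)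
    (hstrict : StrictRanks E rank) (htop : IsTopChoice E rank f)
    (M M' : A → Option B) (hM : IsMatching E M) (hM' : IsMatching E M')
    (P1 P2 P3 : Set B) (hws : WellStructured E rank f M P1 P2 P3)
    (k : ℕ) [NeZero k] (hk : 2 ≤ k)
    (aseq : Fin k → A) (bseq : Fin k → B)
    (hinj : Function.Injective aseq)
    (hmat : ∀ i, M (aseq i) = some (bseq i))
    (hmat' : ∀ i, M' (aseq (i + 1)) = some (bseq i)) :
    (Finset.univ.filter fun i : Fin k =>
        edgeLabel rank M (aseq (i + 1)) (bseq i) = 1).card ≤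
      (Finset.univ.filter fun i : Fin k =>
        edgeLabel rank M (aseq (i + 1)) (bseq i) = -1).card := by
  have hcard : ∑ i : Fin k, edgeLabel rank M (aseq (i + 1)) (bseq i) =
      ((Finset.univ.filter fun i : Fin k =>
        edgeLabel rank M (aseq (i + 1)) (bseq i) = 1).card : ℤ) -
      (Finset.univ.filter fun i : Fin k =>
        edgeLabel rank M (aseq (i + 1)) (bseq i) = -1).card := by
    rw [Finset.card_filter, Finset.card_filter]
    push_cast
    rw [← Finset.sum_sub_distrib]
    refine Finset.sum_congr rfl fun i _ => ?_
    rcases edgeLabel_eq_one_or_neg_one rank M (aseq (i + 1)) (bseq i) with h | h <;> simp [h]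
  have hshift : ∑ i : Fin k, partIndex P1 P2 (bseq (i + 1)) =
      ∑ i : Fin k, partIndex P1 P2 (bseq i) :=
    Equiv.sum_comp (Equiv.addRight (1 : Fin k)) fun i => partIndex P1 P2 (bseq i)
  have hsum : ∑ i : Fin k, edgeLabel rank M (aseq (i + 1)) (bseq i) ≤
      ∑ i : Fin k, (partIndex P1 P2 (bseq (i + 1)) - partIndex P1 P2 (bseq i)) :=
    Finset.sum_le_sum fun i _ =>
      hws.edgeLabel_le htop (hmat (i + 1)) (hM'.1 _ _ (hmat' i))
  rw [hcard, Finset.sum_sub_distrib, hshift] at hsum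
  omega
end
end

section
/- Let G = (A ∪ B, E) be a bipartite graph where each applicant has a strict preference list and each post puts all its neighbors into a single tie, and let M* be a popular matching of G. If (a,b) ∈ M* and b ∈ F, then the rank of b in a's preference list is strictly smaller than r_a. -/
open Classical

noncomputable section

variable {A B : Type*}

/-- An applicant who is not matched to their top choice in `M` prefers any matching
in which they are. -/
lemma aPrefers_of_eq_top {E : A → B → Prop} {rank : A → B → ℕ} {f : A → B}
    (hstrict : StrictRanks E rank) (htop : IsTopChoice E rank f) {M M' : A → Option B}
    (hM : IsMatching E M) {x : A} (hne : M x ≠ some (f x)) (hx : M' x = some (f x)) :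
    APrefers rank M' M x := by
  unfold APrefers
  rw [hx]
  cases h : M x with
  | none => trivial
  | some y =>
    have hE := hM.1 x y h
    refine lt_of_le_of_ne ((htop x).2 y hE) fun heq => hne ?_
    rw [h, hstrict x _ _ (htop x).1 hE heq]

/-- An applicant with the same partner in both matchings abstains. -/
lemma not_aPrefers_of_eq {rank : A → B → ℕ} {M M' : A → Option B} {x : A}
    (h : M x = M' x) : ¬ APrefers rank M M' x := by
  unfold APrefers
  rw [h]
  cases M' x <;> simp

/-- The preferences of an applicant between two matchings are asymmetric. -/
lemma APrefers.asymm {rank : A → B → ℕ} {M M' : A → Option B} {x : A}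
    (h : APrefers rank M M' x) : ¬ APrefers rank M' M x := by
  unfold APrefers at *
  cases hM : M x <;> cases hM' : M' x <;> simp_all
  omega

/-- A matching is not popular if another one is preferred by more applicants than there are
vertices with the opposite preference. -/
lemma not_popular_of_card_lt [Fintype A] [Fintype B] {E : A → B → Prop} {rank : A → B → ℕ}
    {M M' : A → Option B} (hM' : IsMatching E M') (S L : Finset A) (K : Finset B)
    (hS : ∀ x ∈ S, APrefers rank M' M x) (hL : ∀ x, APrefers rank M M' x → x ∈ L)
    (hK : ∀ y, BPrefers M M' y → y ∈ K) (hcard : L.card + K.card < S.card) :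
    ¬ Popular E rank M := by
  intro hpop
  have h := hpop.2 M' hM'
  unfold phi at h
  simp only [Nat.card_eq_fintype_card, Fintype.card_subtype] at h
  have h1 : S.card ≤ (Finset.univ.filter fun x => APrefers rank M' M x).card :=
    Finset.card_le_card fun x hx => by simpa using hS x hx
  have h2 : (Finset.univ.filter fun x => APrefers rank M M' x).card ≤ L.card :=
    Finset.card_le_card fun x hx => hL x (by simpa using hx)
  have h3 : (Finset.univ.filter fun y => BPrefers M M' y).card ≤ K.card :=
    Finset.card_le_card fun y hy => hK y (by simpa using hy)
  omega

/-- At most one applicant is matched to a given post. -/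
lemma IsMatching.card_filter_le_one [Fintype A] {E : A → B → Prop} {M : A → Option B}
    (hM : IsMatching E M) (y : B) :
    (Finset.univ.filter fun x => M x = some y).card ≤ 1 :=
  Finset.card_le_one.2 fun u hu v hv =>
    hM.2 u v y (by simpa using hu) (by simpa using hv)

/-- If `a` prefers `c` to its partner `b = f a'`, where `c` is free or matched to `a'`, then
matching `a` to `c` and `a'` to `b` shows that `M` is not popular. -/
lemma not_popular_of_promote_two [Fintype A] [Fintype B]
    {E : A → B → Prop} {rank : A → B → ℕ} {f : A → B}
    (hstrict : StrictRanks E rank) (htop : IsTopChoice E rank f)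
    {M : A → Option B} (hM : IsMatching E M) {a a' : A} {c : B}
    (hab : M a = some (f a')) (haa' : a ≠ a') (hac : E a c)
    (hlt : rank a c < rank a (f a')) (hc : ∀ x, M x = some c → x = a') :
    ¬ Popular E rank M := by
  obtain ⟨M', hM'⟩ : ∃ M' : A → Option B, ∀ x, M' x =
      if x = a then some c else if x = a' then some (f a') else M x := ⟨_, fun _ => rfl⟩
  have hcb : c ≠ f a' := fun h => by simp [h] at hlt
  have ha : M' a = some c := by simp [hM']
  have ha' : M' a' = some (f a') := by simp [hM', haa'.symm]
  have hrest : ∀ x, x ≠ a → x ≠ a' → M' x = M x := fun x h h' => by simp [hM', h, h']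
  have hmatch : IsMatching E M' := by
    have hE := (htop a').1
    obtain ⟨hM1, hM2⟩ := hM
    refine ⟨fun x y h => ?_, fun x x' y h h' => ?_⟩ <;> grind
  have pa : APrefers rank M' M a := by simpa [APrefers, ha, hab] using hlt
  have pa' : APrefers rank M' M a' :=
    aPrefers_of_eq_top hstrict htop hM (fun h => haa' (hM.2 _ _ _ hab h)) ha'
  refine not_popular_of_card_lt hmatch {a, a'} ∅ (M a').toFinset ?_ ?_ ?_ ?_
  · simp [pa, pa']
  · intro x hx
    by_cases h : x = a
    · exact absurd (h ▸ hx) pa.asymm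
    by_cases h' : x = a'
    · exact absurd (h' ▸ hx) pa'.asymm
    exact absurd hx (not_aPrefers_of_eq (hrest x h h').symm)
  · rintro y ⟨⟨x, hx⟩, hy⟩
    have hy' : ∀ x, M' x ≠ some y := fun x h => hy ⟨x, h⟩
    rw [Option.mem_toFinset, Option.mem_def]
    grind
  · have : (M a').toFinset.card ≤ 1 := by cases M a' <;> simp
    rw [Finset.card_pair haa', Finset.card_empty]
    omega

/-- If `a` prefers `c` to its partner `b = f a'`, where `c` is matched to `d` with
`f d ≠ c` and `f d ≠ b`, then promoting `a`, `a'` and `d` to `c`, `f a'` and `f d`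
shows that `M` is not popular. -/
lemma not_popular_of_promote_three [Fintype A] [Fintype B]
    {E : A → B → Prop} {rank : A → B → ℕ} {f : A → B}
    (hstrict : StrictRanks E rank) (htop : IsTopChoice E rank f)
    {M : A → Option B} (hM : IsMatching E M) {a a' d : A} {c : B}
    (hab : M a = some (f a')) (haa' : a ≠ a') (hac : E a c)
    (hlt : rank a c < rank a (f a')) (hc : M d = some c)
    (hgc : f d ≠ c) (hgb : f d ≠ f a') :
    ¬ Popular E rank M := by
  obtain ⟨M', hM'⟩ : ∃ M' : A → Option B, ∀ x, M' x =
      if x = a then some c else if x = a' then some (f a') else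
      if x = d then some (f d) else if M x = some (f d) then none else M x :=
    ⟨_, fun _ => rfl⟩
  have hcb : c ≠ f a' := fun h => by simp [h] at hlt
  have had : a ≠ d := by
    rintro rfl
    exact hcb (Option.some.inj (hc.symm.trans hab))
  have hne : a' ≠ d := fun h => hgb (congrArg f h.symm)
  have ha : M' a = some c := by simp [hM']
  have ha' : M' a' = some (f a') := by simp [hM', haa'.symm]
  have hd : M' d = some (f d) := by simp [hM', had.symm, hne.symm]
  have hrest : ∀ x, x ≠ a → x ≠ a' → x ≠ d → M x ≠ some (f d) → M' x = M x :=
    fun x h h' hxd hg => by simp [hM', h, h', hxd, hg]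
  have hmatch : IsMatching E M' := by
    have hE := (htop a').1
    have hE' := (htop d).1
    obtain ⟨hM1, hM2⟩ := hM
    refine ⟨fun x y h => ?_, fun x x' y h h' => ?_⟩ <;> grind
  have pa : APrefers rank M' M a := by simpa [APrefers, ha, hab] using hlt
  have pa' : APrefers rank M' M a' :=
    aPrefers_of_eq_top hstrict htop hM (fun h => haa' (hM.2 _ _ _ hab h)) ha'
  have pd : APrefers rank M' M d :=
    aPrefers_of_eq_top hstrict htop hM
      (fun h => hgc (Option.some.inj (h.symm.trans hc))) hd
  refine not_popular_of_card_lt hmatch {a, a', d}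
    (Finset.univ.filter fun x => M x = some (f d)) (M a').toFinset ?_ ?_ ?_ ?_
  · simp [pa, pa', pd]
  · intro x hx
    by_contra hg
    by_cases h : x = a
    · exact absurd (h ▸ hx) pa.asymm
    by_cases h' : x = a'
    · exact absurd (h' ▸ hx) pa'.asymm
    by_cases hxd : x = d
    · exact absurd (hxd ▸ hx) pd.asymm
    exact not_aPrefers_of_eq (hrest x h h' hxd (by simpa using hg)).symm hx
  · rintro y ⟨⟨x, hx⟩, hy⟩
    have hy' : ∀ x, M' x ≠ some y := fun x h => hy ⟨x, h⟩
    rw [Option.mem_toFinset, Option.mem_def]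
    grind
  · have h1 : (M a').toFinset.card ≤ 1 := by cases M a' <;> simp
    have h2 := hM.card_filter_le_one (f d)
    have h3 : ({a, a', d} : Finset A).card = 3 :=
      Finset.card_eq_three.2 ⟨a, a', d, haa', had, hne, rfl⟩
    omega

/-- If `M*` is a popular matching, `(a, b) ∈ M*` and `b ∈ F`, then
the rank of `b` in `a`'s preference list is strictly smaller than `r_a`. -/
theorem rank_lt_rVal_of_popular
    [Fintype A] [Fintype B]
    (E : A → B → Prop) (rank : A → B → ℕ) (f : A → B)
    (hstrict : StrictRanks E rank) (htop : IsTopChoice E rank f)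
    (M : A → Option B) (hpop : Popular E rank M)
    (a : A) (b : B) (hab : M a = some b) (hbF : b ∈ Set.range f) :
    (rank a b : ℕ∞) < rVal E rank (Set.range f) a := by
  have hM := hpop.1
  have hEab := hM.1 a b hab
  by_contra hle
  obtain ⟨c, hac, hcF, hcb⟩ : ∃ c, E a c ∧ c ∉ Set.range f ∧ rank a c ≤ rank a b := by
    by_contra! hno
    apply hle
    have hsucc : ((rank a b + 1 : ℕ) : ℕ∞) ≤ rVal E rank (Set.range f) a := by
      refine le_sInf ?_
      rintro x ⟨c, hac, hcF, rfl⟩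
      exact_mod_cast hno c hac hcF
    exact lt_of_lt_of_le (by exact_mod_cast Nat.lt_succ_self _) hsucc
  have hlt : rank a c < rank a b :=
    lt_of_le_of_ne hcb fun h => hcF (hstrict a c b hac hEab h ▸ hbF)
  obtain ⟨a', rfl⟩ := hbF
  have htop_ne : ∀ x, f x = f a' → a ≠ x := by
    rintro x hx rfl
    have := (htop a).2 c hac
    rw [hx] at this
    omega
  by_cases hc : ∃ x, M x = some c
  · obtain ⟨d, hc⟩ := hc
    by_cases hg : f d = f a'
    · rw [← hg] at hab hlt
      exact not_popular_of_promote_two hstrict htop hM hab (htop_ne d hg) hac hlt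
        (fun x hx => hM.2 x d c hx hc) hpop
    · exact not_popular_of_promote_three hstrict htop hM hab (htop_ne a' rfl) hac hlt hc
        (fun h => hcF ⟨d, h⟩) hg hpop
  · exact not_popular_of_promote_two hstrict htop hM hab (htop_ne a' rfl) hac hlt
      (fun x hx => absurd ⟨x, hx⟩ hc) hpop
end
end

section
/- Let G = (A ∪ B, E) be a bipartite graph where each applicant has a strict preference list and each post puts all its neighbors into a single tie, let M* be a popular matching of G, and let a ∈ A be unmatched in M*. Then every neighbor b of a belongs to F (equivalently, r_a = ∞); moreover, every neighbor b of a is matched in M* to an applicant a0 with f(a0) = b. -/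
open Classical

noncomputable section

variable {A B : Type*}

/-- A popular matching is not beaten among the applicants by a matching that covers every post
it covers. -/
theorem Popular.card_aPrefers_le [Finite A] [Finite B] {E : A → B → Prop} {rank : A → B → ℕ}
    {M M' : A → Option B} (hpop : Popular E rank M) (hM' : IsMatching E M')
    (hcover : ∀ b, PostMatched M b → PostMatched M' b) :
    Nat.card {x : A // APrefers rank M' M x} ≤ Nat.card {x : A // APrefers rank M M' x} := by
  have h := hpop.2 M' hM'
  have : IsEmpty {b : B // BPrefers M M' b} := ⟨fun b => b.2.2 (hcover _ b.2.1)⟩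
  have h0 : Nat.card {b : B // BPrefers M M' b} = 0 := Nat.card_of_isEmpty
  unfold phi at h
  omega

/-- Every neighbor of an applicant left unmatched by a popular matching is matched. -/
theorem Popular.postMatched_of_unmatched [Finite A] [Finite B] {E : A → B → Prop}
    {rank : A → B → ℕ} {M : A → Option B} (hpop : Popular E rank M) {a : A} (ha : M a = none)
    {b : B} (hab : E a b) : PostMatched M b := by
  by_contra hb
  have hb' : ∀ x, M x ≠ some b := fun x hx => hb ⟨x, hx⟩
  obtain ⟨hE, hinj⟩ := hpop.1
  let M' : A → Option B := fun x => if x = a then some b else M x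
  have hM' : IsMatching E M' := by
    constructor <;> grind
  have hcover : ∀ c, PostMatched M c → PostMatched M' c := by
    rintro c ⟨x, hx⟩
    exact ⟨x, by grind⟩
  have hle := hpop.card_aPrefers_le hM' hcover
  have hpos : Nonempty {x : A // APrefers rank M' M x} := ⟨a, by simp [APrefers, M', ha]⟩
  have hempty : IsEmpty {x : A // APrefers rank M M' x} := by
    refine ⟨fun ⟨x, hx⟩ => ?_⟩
    by_cases hxa : x = a
    · subst hxa
      simp [APrefers, ha] at hx
    · cases h : M x <;> simp [APrefers, M', hxa, h] at hx
  have h0 : Nat.card {x : A // APrefers rank M M' x} = 0 := Nat.card_of_isEmpty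
  have h1 : 0 < Nat.card {x : A // APrefers rank M' M x} := Nat.card_pos
  omega

/-- In a popular matching, a neighbor of an unmatched applicant can only be matched to an applicant
for whom it is the top choice. -/
theorem Popular.topChoice_eq_of_unmatched [Finite A] [Finite B] {E : A → B → Prop}
    {rank : A → B → ℕ} {f : A → B} (hstrict : StrictRanks E rank) (htop : IsTopChoice E rank f)
    {M : A → Option B} (hpop : Popular E rank M) {a : A} (ha : M a = none)
    {b : B} (hab : E a b) {a₀ : A} (h₀ : M a₀ = some b) : f a₀ = b := by
  by_contra hne
  obtain ⟨hE, hinj⟩ := hpop.1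
  have haa₀ : a₀ ≠ a := by
    rintro rfl
    simp [ha] at h₀
  have hlt : rank a₀ (f a₀) < rank a₀ b :=
    lt_of_le_of_ne ((htop a₀).2 b (hE _ _ h₀))
      fun h => hne (hstrict a₀ _ _ (htop a₀).1 (hE _ _ h₀) h)
  have hf := (htop a₀).1
  let M' : A → Option B := fun x =>
    if x = a then some b else if x = a₀ then some (f a₀)
    else if M x = some (f a₀) then none else M x
  have hM' : IsMatching E M' := by
    constructor <;> grind
  have hcover : ∀ c, PostMatched M c → PostMatched M' c := by
    rintro c ⟨x, hx⟩
    by_cases hcb : c = b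
    · exact ⟨a, by grind⟩
    by_cases hcf : c = f a₀
    · exact ⟨a₀, by grind⟩
    exact ⟨x, by grind⟩
  have hle := hpop.card_aPrefers_le hM' hcover
  have hnontrivial : Nontrivial {x : A // APrefers rank M' M x} :=
    ⟨⟨a, by simp [APrefers, M', ha]⟩, ⟨a₀, by simpa [APrefers, M', haa₀, h₀] using hlt⟩,
      fun h => haa₀ (congrArg Subtype.val h).symm⟩
  have hloser : ∀ x, APrefers rank M M' x → M x = some (f a₀) := by
    intro x hx
    by_contra hxf
    by_cases hxa : x = a
    · subst hxa
      simp [APrefers, ha] at hx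
    by_cases hx₀ : x = a₀
    · subst hx₀
      simp [APrefers, M', hxa, h₀] at hx
      omega
    · cases h : M x <;> simp_all [APrefers, M']
  have hsub : Subsingleton {x : A // APrefers rank M M' x} :=
    ⟨fun x y => Subtype.ext (hinj _ _ _ (hloser _ x.2) (hloser _ y.2))⟩
  have h1 := Finite.card_le_one_iff_subsingleton.2 hsub
  have h2 := Finite.one_lt_card_iff_nontrivial.2 hnontrivial
  omega

/-- If `M*` is popular and `a` is unmatched in `M*`, then every
neighbor of `a` lies in `F` (equivalently `r_a = ∞`), and every neighbor `b` of `a`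
is matched in `M*` to an applicant `a₀` with `f a₀ = b`. -/
theorem unmatched_applicant_of_popular
    [Fintype A] [Fintype B]
    (E : A → B → Prop) (rank : A → B → ℕ) (f : A → B)
    (hstrict : StrictRanks E rank) (htop : IsTopChoice E rank f)
    (M : A → Option B) (hpop : Popular E rank M)
    (a : A) (ha : M a = none) :
    (∀ b, E a b → b ∈ Set.range f) ∧
    rVal E rank (Set.range f) a = ⊤ ∧
    (∀ b, E a b → ∃ a₀, M a₀ = some b ∧ f a₀ = b) := by
  have hmatched : ∀ b, E a b → ∃ a₀, M a₀ = some b ∧ f a₀ = b := fun b hab =>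
    let ⟨a₀, h₀⟩ := hpop.postMatched_of_unmatched ha hab
    ⟨a₀, h₀, hpop.topChoice_eq_of_unmatched hstrict htop ha hab h₀⟩
  have hrange : ∀ b, E a b → b ∈ Set.range f := fun b hab =>
    let ⟨a₀, _, h⟩ := hmatched b hab
    ⟨a₀, h⟩
  refine ⟨hrange, ?_, hmatched⟩
  rw [rVal, sInf_eq_top]
  rintro x ⟨b, hab, hb, -⟩
  exact absurd (hrange b hab) hb
end
end

section
/- Let I be a (2,2)-E3-SAT instance and G_I the bipartite graph constructed from I. Given a truth assignment σ satisfying I, define the matching M as follows: for each variable v_j, if σ(v_j) is true then M contains (a_{j1},b_{j1}) and (a_{j2},b_{j2}), and otherwise M contains (a_{j1},b_{j2}) and (a_{j2},b_{j1}); for each clause C_i, choose an index k such that the k-th literal of C_i is true under σ, and M contains (x_{ik},c_i), (x_{i(k+1)},y_{i(k+1)}) and (x_{i(k+2)},y_{i(k+2)}) (indices mod 3); M contains no interconnecting edge. Then M is a popular matching of G_I. -/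
open Classical

noncomputable section

variable {A B : Type*}

/-- Post `b` (with preference list `prank b`, possibly containing ties) prefers `M`
to `M'`: either matched in `M` and unmatched in `M'`, or matched in both to a
strictly better-ranked partner in `M`. -/
def BPrefersGen (prank : B → A → ℕ) (M M' : A → Option B) (b : B) : Prop :=
  (PostMatched M b ∧ ¬ PostMatched M' b) ∨
    ∃ a a', M a = some b ∧ M' a' = some b ∧ prank b a < prank b a'

/-- Number of vertices preferring `M` to `M'` when posts have general preference lists. -/
def phiGen (rank : A → B → ℕ) (prank : B → A → ℕ) (M M' : A → Option B) : ℕ :=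
  Nat.card {a : A // APrefers rank M M' a} +
    Nat.card {b : B // BPrefersGen prank M M' b}

/-- `M` is a popular matching (two-sided votes; posts have preference lists `prank`). -/
def PopularGen (E : A → B → Prop) (rank : A → B → ℕ) (prank : B → A → ℕ)
    (M : A → Option B) : Prop :=
  IsMatching E M ∧ ∀ M', IsMatching E M' →
    phiGen rank prank M' M ≤ phiGen rank prank M M'

/-! ## The (2,2)-E3-SAT construction

A (2,2)-E3-SAT instance with `n` variables and `m` clauses is given by
`lit : Fin m → Fin 3 → Fin n × Bool`, where `lit i k = (j, s)` means that the
`k`-th literal of clause `C_i` is the variable `v_j`, unnegated if `s = true`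
and negated if `s = false`. -/

/-- Every variable appears exactly twice unnegated and exactly twice negated. -/
def TwoTwo {n m : ℕ} (lit : Fin m → Fin 3 → Fin n × Bool) : Prop :=
  ∀ (j : Fin n) (s : Bool),
    (Finset.univ.filter fun p : Fin m × Fin 3 => lit p.1 p.2 = (j, s)).card = 2

/-- Applicants of `G_I`: `Sum.inl (j, true)` is `a_{j1}` (the unnegated side),
`Sum.inl (j, false)` is `a_{j2}` (the negated side), `Sum.inr (i, k)` is `x_{ik}`. -/
abbrev AI (n m : ℕ) := (Fin n × Bool) ⊕ (Fin m × Fin 3)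

/-- Posts of `G_I`: `Sum.inl (j, true)` is `b_{j1}`, `Sum.inl (j, false)` is `b_{j2}`,
`Sum.inr (Sum.inl i)` is `c_i`, and `Sum.inr (Sum.inr (i, k))` is `y_{ik}`. -/
abbrev BI (n m : ℕ) := (Fin n × Bool) ⊕ (Fin m ⊕ (Fin m × Fin 3))

/-- The edges of `G_I`: each variable gadget is a 4-cycle on `a_{j1}, a_{j2}, b_{j1}, b_{j2}`;
each `x_{ik}` is adjacent to `c_i` and to `y_{ik}`; and `y_{ik}` is joined by an
interconnecting edge to `a_{j1}` (resp. `a_{j2}`) if the `k`-th literal of `C_i`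
is `v_j` (resp. `¬ v_j`). -/
def EI {n m : ℕ} (lit : Fin m → Fin 3 → Fin n × Bool) : AI n m → BI n m → Prop
  | Sum.inl (j, _), Sum.inl (j', _) => j = j'
  | Sum.inl (j, t), Sum.inr (Sum.inr (i, k)) => lit i k = (j, t)
  | Sum.inl _, Sum.inr (Sum.inl _) => False
  | Sum.inr (i, _), Sum.inr (Sum.inl i') => i = i'
  | Sum.inr (i, k), Sum.inr (Sum.inr p) => p = (i, k)
  | Sum.inr _, Sum.inl _ => False

/-- The number of occurrences of variable `j` with sign `t` occurring (in the fixed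
lexicographic order on occurrences) strictly before the occurrence `(i, k)`;
used to order the two `y`-neighbors of `a_{jt}` in its preference list. -/
def occBefore {n m : ℕ} (lit : Fin m → Fin 3 → Fin n × Bool)
    (j : Fin n) (t : Bool) (i : Fin m) (k : Fin 3) : ℕ :=
  (Finset.univ.filter fun p : Fin m × Fin 3 =>
     lit p.1 p.2 = (j, t) ∧ (p.1 < i ∨ (p.1 = i ∧ p.2 < k))).card

/-- The applicants' (strict) preference lists of `G_I`, as a rank function
(lower rank = more preferred; the value on non-edges is irrelevant):
`x_{ik}` ranks `c_i` first and `y_{ik}` second; `a_{jt}` ranks `b_{j1}` first,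
its two interconnecting `y`-neighbors second and third (in a fixed order),
and `b_{j2}` fourth. -/
def rankI {n m : ℕ} (lit : Fin m → Fin 3 → Fin n × Bool) : AI n m → BI n m → ℕ
  | Sum.inl _, Sum.inl (_, s) => if s then 1 else 4
  | Sum.inl (j, t), Sum.inr (Sum.inr (i, k)) => 2 + occBefore lit j t i k
  | Sum.inl _, Sum.inr (Sum.inl _) => 0
  | Sum.inr _, Sum.inr (Sum.inl _) => 1
  | Sum.inr _, Sum.inr (Sum.inr _) => 2
  | Sum.inr _, Sum.inl _ => 0

/-- The posts' preference lists of `G_I`: each `y_{ik}` ranks `x_{ik}` first and its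
interconnecting `a`-neighbor second; each `c_i` puts its three neighbors
`x_{i1}, x_{i2}, x_{i3}` into a single tie, and each `b_{js}` puts its two neighbors
`a_{j1}, a_{j2}` into a single tie. -/
def prankI {n m : ℕ} : BI n m → AI n m → ℕ
  | Sum.inr (Sum.inr _), Sum.inr _ => 1
  | Sum.inr (Sum.inr _), Sum.inl _ => 2
  | _, _ => 1

/-- The matching built from a satisfying assignment `σ` together with a choice
`choice i` of a true literal in each clause `C_i`: if `σ v_j` is true take
`(a_{j1}, b_{j1}), (a_{j2}, b_{j2})`, otherwise `(a_{j1}, b_{j2}), (a_{j2}, b_{j1})`;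
in clause `C_i`, `x_{i,choice i}` is matched to `c_i`, the other two `x_{ik}` to their
`y_{ik}`, and `y_{i,choice i}` is left unmatched. No interconnecting edge is used. -/
def Msat {n m : ℕ} (σ : Fin n → Bool) (choice : Fin m → Fin 3) :
    AI n m → Option (BI n m)
  | Sum.inl (j, t) => some (Sum.inl (j, t == σ j))
  | Sum.inr (i, k) =>
      if k = choice i then some (Sum.inr (Sum.inl i))
      else some (Sum.inr (Sum.inr (i, k)))

/-- The signed vote of an agent who prefers the new matching when `P` holds and the
old one when `Q` holds. -/
def signedVote (P Q : Prop) : ℤ := (if P then 1 else 0) - (if Q then 1 else 0)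

lemma signedVote_le_one (P Q : Prop) : signedVote P Q ≤ 1 := by
  unfold signedVote; split_ifs <;> simp

lemma signedVote_le_zero {P Q : Prop} (hP : ¬ P) : signedVote P Q ≤ 0 := by
  unfold signedVote; split_ifs <;> simp

lemma signedVote_le_neg_one {P Q : Prop} (hP : ¬ P) (hQ : Q) : signedVote P Q ≤ -1 := by
  simp [signedVote, hP, hQ]

lemma sum_signedVote {ι : Type*} [Fintype ι] (P Q : ι → Prop) :
    ∑ i, signedVote (P i) (Q i) = (Nat.card {i // P i} : ℤ) - Nat.card {i // Q i} := by
  simp [signedVote, Finset.sum_sub_distrib, Nat.card_eq_fintype_card, Fintype.card_subtype]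

/-- A function pair which is nonpositive on the matched edges and on the unmatched
vertices of a matching has nonpositive total. -/
lemma sum_add_sum_nonpos_of_matching [Fintype A] [Fintype B]
    {E : A → B → Prop} {N : A → Option B} (hN : IsMatching E N) (d : A → ℤ) (e : B → ℤ)
    (hedge : ∀ a b, N a = some b → d a + e b ≤ 0)
    (hA : ∀ a, N a = none → d a ≤ 0) (hB : ∀ b, ¬ PostMatched N b → e b ≤ 0) :
    ∑ a, d a + ∑ b, e b ≤ 0 := by
  have hle : ∑ b, e b ≤ ∑ b, ∑ a, if N a = some b then e b else 0 := by
    refine Finset.sum_le_sum fun b _ => ?_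
    by_cases hb : PostMatched N b
    · obtain ⟨a, ha⟩ := hb
      rw [Finset.sum_eq_single a]
      · simp [ha]
      · exact fun a' _ hne => if_neg fun h => hne (hN.2 _ _ _ h ha)
      · simp
    · rw [Finset.sum_eq_zero fun a _ => if_neg fun h => hb ⟨a, h⟩]
      exact hB b hb
  rw [Finset.sum_comm] at hle
  have hnonpos : ∑ a, (d a + ∑ b, if N a = some b then e b else 0) ≤ 0 := by
    refine Finset.sum_nonpos fun a _ => ?_
    cases h : N a with
    | none => simpa using hA a h
    | some b => simpa using hedge a b h
  rw [Finset.sum_add_distrib] at hnonpos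
  linarith

/-- Weak duality: a matching admitting a zero-sum potential that dominates the votes
for any other matching is popular. -/
lemma popularGen_of_potential [Fintype A] [Fintype B]
    {E : A → B → Prop} {rank : A → B → ℕ} {prank : B → A → ℕ} {M : A → Option B}
    (hM : IsMatching E M) (α : A → ℤ) (β : B → ℤ) (hsum : ∑ a, α a + ∑ b, β b = 0)
    (hedge : ∀ N, IsMatching E N → ∀ a b, N a = some b →
      signedVote (APrefers rank N M a) (APrefers rank M N a) +
        signedVote (BPrefersGen prank N M b) (BPrefersGen prank M N b) ≤ α a + β b)
    (hA : ∀ N, IsMatching E N → ∀ a, N a = none →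
      signedVote (APrefers rank N M a) (APrefers rank M N a) ≤ α a)
    (hB : ∀ N, IsMatching E N → ∀ b, ¬ PostMatched N b →
      signedVote (BPrefersGen prank N M b) (BPrefersGen prank M N b) ≤ β b) :
    PopularGen E rank prank M := by
  refine ⟨hM, fun N hN => ?_⟩
  have h := sum_add_sum_nonpos_of_matching hN
    (fun a => signedVote (APrefers rank N M a) (APrefers rank M N a) - α a)
    (fun b => signedVote (BPrefersGen prank N M b) (BPrefersGen prank M N b) - β b)
    (fun a b hab => by linarith [hedge N hN a b hab])
    (fun a ha => by linarith [hA N hN a ha])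
    (fun b hb => by linarith [hB N hN b hb])
  rw [Finset.sum_sub_distrib, Finset.sum_sub_distrib, sum_signedVote, sum_signedVote] at h
  unfold phiGen
  zify
  linarith

section Votes

variable {E : A → B → Prop} {prank : B → A → ℕ} {M N : A → Option B}

/-- A post matched to a best-ranked applicant never prefers another matching. -/
lemma not_bPrefersGen_of_best (hM : IsMatching E M) {a : A} {b : B} (ha : M a = some b)
    (hbest : ∀ a', prank b a ≤ prank b a') : ¬ BPrefersGen prank N M b := by
  rintro (⟨-, h⟩ | ⟨a₁, a₂, -, h₂, hlt⟩)
  · exact h ⟨a, ha⟩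
  · obtain rfl := hM.2 _ _ _ h₂ ha
    exact absurd (hbest a₁) (not_le.mpr hlt)

lemma not_bPrefersGen_of_not_postMatched {b : B} (hb : ¬ PostMatched N b) :
    ¬ BPrefersGen prank N M b := by
  rintro (⟨h, -⟩ | ⟨a, -, h, -⟩)
  · exact hb h
  · exact hb ⟨a, h⟩

end Votes

section Construction

variable {n m : ℕ} (σ : Fin n → Bool) (choice : Fin m → Fin 3)

/-- The applicants' part of the dual certificate for `Msat σ choice`. -/
def applicantPotential : AI n m → ℤ
  | Sum.inl (j, t) => if t = σ j then 0 else 1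
  | Sum.inr (i, k) => if k = choice i then 0 else 1

/-- The posts' part of the dual certificate for `Msat σ choice`. -/
def postPotential : BI n m → ℤ
  | Sum.inl (_, s) => if s then 0 else -1
  | Sum.inr (Sum.inl _) => 0
  | Sum.inr (Sum.inr (i, k)) => if k = choice i then 0 else -1

lemma sum_potential :
    ∑ a : AI n m, applicantPotential σ choice a + ∑ b : BI n m, postPotential choice b = 0 := by
  have hvar : ∑ p : Fin n × Bool, (if p.2 = σ p.1 then 0 else 1 : ℤ) +
      ∑ p : Fin n × Bool, (if p.2 then 0 else -1 : ℤ) = 0 := by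
    rw [← Finset.sum_add_distrib, Fintype.sum_prod_type]
    refine Finset.sum_eq_zero fun j _ => ?_
    cases h : σ j <;> simp [h]
  have hclause : ∑ p : Fin m × Fin 3, (if p.2 = choice p.1 then 0 else 1 : ℤ) +
      ∑ p : Fin m × Fin 3, (if p.2 = choice p.1 then 0 else -1 : ℤ) = 0 := by
    rw [← Finset.sum_add_distrib]
    exact Finset.sum_eq_zero fun p _ => by split_ifs <;> simp
  simp only [Fintype.sum_sum_type, applicantPotential, postPotential, Finset.sum_const_zero]
  linarith

lemma isMatching_Msat (lit : Fin m → Fin 3 → Fin n × Bool) :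
    IsMatching (EI lit) (Msat σ choice) := by
  refine ⟨?_, ?_⟩
  · rintro (⟨j, t⟩ | ⟨i, k⟩) b h
    · simp only [Msat, Option.some.injEq] at h
      subst h
      simp [EI]
    · simp only [Msat] at h
      split_ifs at h <;> simp only [Option.some.injEq] at h <;> subst h <;> simp [EI]
  · rintro (⟨j, t⟩ | ⟨i, k⟩) (⟨j', t'⟩ | ⟨i', k'⟩) b h h'
    · simp only [Msat, Option.some.injEq] at h h'
      subst h
      simp only [Sum.inl.injEq, Prod.mk.injEq] at h'
      obtain ⟨rfl, h'⟩ := h'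
      cases t <;> cases t' <;> cases hs : σ j' <;> simp_all
    · grind [Msat]
    · grind [Msat]
    · grind [Msat]

/-- Every post other than an unmatched `y` has its best-ranked partner in `Msat`. -/
lemma not_bPrefersGen_Msat (lit : Fin m → Fin 3 → Fin n × Bool) {N : AI n m → Option (BI n m)}
    {b : BI n m} (hb : PostMatched (Msat σ choice) b) :
    ¬ BPrefersGen prankI N (Msat σ choice) b := by
  obtain ⟨a, ha⟩ := hb
  refine not_bPrefersGen_of_best (isMatching_Msat σ choice lit) ha fun a' => ?_
  rcases a with ⟨j, t⟩ | ⟨i, k⟩ <;> rcases b with _ | _ | _ <;> rcases a' with _ | _ <;>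
    simp_all [Msat, prankI]

lemma postMatched_Msat_variable (j : Fin n) (s : Bool) :
    PostMatched (Msat σ choice) (Sum.inl (j, s)) :=
  ⟨Sum.inl (j, s == σ j), by cases s <;> cases h : σ j <;> simp [Msat, h]⟩

lemma postMatched_Msat_clause (i : Fin m) :
    PostMatched (Msat σ choice) (Sum.inr (Sum.inl i)) :=
  ⟨Sum.inr (i, choice i), by simp [Msat]⟩

lemma Msat_literal {i : Fin m} {k : Fin 3} (hk : k ≠ choice i) :
    Msat σ choice (Sum.inr (i, k)) = some (Sum.inr (Sum.inr (i, k))) := by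
  simp [Msat, hk]

end Construction

/-- Given a (2,2)-E3-SAT instance, a satisfying assignment `σ`, and a
choice of a true literal in each clause, the matching `Msat σ choice` is a popular
matching of `G_I`. -/
theorem Msat_popular (n m : ℕ) (lit : Fin m → Fin 3 → Fin n × Bool)
    (htwo : TwoTwo lit)
    (σ : Fin n → Bool) (choice : Fin m → Fin 3)
    (hchoice : ∀ i, σ (lit i (choice i)).1 = (lit i (choice i)).2) :
    PopularGen (EI lit) (rankI lit) prankI (Msat σ choice) := by
  refine popularGen_of_potential (isMatching_Msat σ choice lit) (applicantPotential σ choice)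
    (postPotential choice) (sum_potential σ choice) ?_ ?_ ?_
  · rintro N hN (⟨j, t⟩ | ⟨i, k⟩) (⟨j', s⟩ | i' | ⟨i', k'⟩) hab <;> have hE := hN.1 _ _ hab
    · obtain rfl : j = j' := hE
      have hpost := signedVote_le_zero
        (Q := BPrefersGen prankI (Msat σ choice) N (Sum.inl (j, s)))
        (not_bPrefersGen_Msat σ choice lit (N := N) (postMatched_Msat_variable σ choice j s))
      have happ : signedVote (APrefers (rankI lit) N (Msat σ choice) (Sum.inl (j, t)))
          (APrefers (rankI lit) (Msat σ choice) N (Sum.inl (j, t))) ≤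
          applicantPotential σ choice (Sum.inl (j, t)) +
            postPotential choice (Sum.inl (j, s)) := by
        cases t <;> cases s <;> cases h : σ j <;>
          simp [signedVote, APrefers, hab, Msat, h, rankI, applicantPotential, postPotential]
      linarith
    · exact hE.elim
    · have hlit : lit i' k' = (j, t) := hE
      by_cases hk : k' = choice i'
      · subst hk
        have hσ : σ j = t := by simpa [hlit] using hchoice i'
        have hpost := signedVote_le_one
          (BPrefersGen prankI N (Msat σ choice) (Sum.inr (Sum.inr (i', choice i'))))
          (BPrefersGen prankI (Msat σ choice) N (Sum.inr (Sum.inr (i', choice i'))))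
        have happ : signedVote (APrefers (rankI lit) N (Msat σ choice) (Sum.inl (j, t)))
            (APrefers (rankI lit) (Msat σ choice) N (Sum.inl (j, t))) ≤ -1 := by
          apply signedVote_le_neg_one <;> simp [APrefers, hab, Msat, hσ, rankI]; omega
        simp only [applicantPotential, postPotential, hσ, if_true]
        linarith
      · have hpost := signedVote_le_neg_one
          (Q := BPrefersGen prankI (Msat σ choice) N (Sum.inr (Sum.inr (i', k'))))
          (not_bPrefersGen_Msat σ choice lit (N := N) ⟨_, Msat_literal σ choice hk⟩)
          (Or.inr ⟨_, _, Msat_literal σ choice hk, hab, by simp [prankI]⟩)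
        by_cases ht : t = σ j
        · subst ht
          have happ : signedVote (APrefers (rankI lit) N (Msat σ choice) (Sum.inl (j, σ j)))
              (APrefers (rankI lit) (Msat σ choice) N (Sum.inl (j, σ j))) ≤ 0 := by
            apply signedVote_le_zero
            simp [APrefers, hab, Msat, rankI]
          simp only [applicantPotential, postPotential, hk, if_true, if_false]
          linarith
        · have happ := signedVote_le_one
            (APrefers (rankI lit) N (Msat σ choice) (Sum.inl (j, t)))
            (APrefers (rankI lit) (Msat σ choice) N (Sum.inl (j, t)))
          simp only [applicantPotential, postPotential, ht, hk, if_false]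
          linarith
    · exact hE.elim
    · obtain rfl : i = i' := hE
      have hpost := signedVote_le_zero
        (Q := BPrefersGen prankI (Msat σ choice) N (Sum.inr (Sum.inl i)))
        (not_bPrefersGen_Msat σ choice lit (N := N) (postMatched_Msat_clause σ choice i))
      have happ : signedVote (APrefers (rankI lit) N (Msat σ choice) (Sum.inr (i, k)))
          (APrefers (rankI lit) (Msat σ choice) N (Sum.inr (i, k))) ≤
          applicantPotential σ choice (Sum.inr (i, k)) := by
        by_cases hk : k = choice i
        · subst hk
          simp [signedVote, APrefers, hab, Msat, applicantPotential]
        · simp [signedVote, APrefers, hab, Msat, hk, rankI, applicantPotential]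
      simp only [postPotential]
      linarith
    · obtain ⟨rfl, rfl⟩ : i' = i ∧ k' = k := Prod.mk.inj hE
      by_cases hk : k' = choice i'
      · subst hk
        have hpost := signedVote_le_one
          (BPrefersGen prankI N (Msat σ choice) (Sum.inr (Sum.inr (i', choice i'))))
          (BPrefersGen prankI (Msat σ choice) N (Sum.inr (Sum.inr (i', choice i'))))
        have happ : signedVote (APrefers (rankI lit) N (Msat σ choice) (Sum.inr (i', choice i')))
            (APrefers (rankI lit) (Msat σ choice) N (Sum.inr (i', choice i'))) ≤ -1 := by
          simp [signedVote, APrefers, hab, Msat, rankI]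
        simp only [applicantPotential, postPotential, if_true]
        linarith
      · have hpost := signedVote_le_zero
          (Q := BPrefersGen prankI (Msat σ choice) N (Sum.inr (Sum.inr (i', k'))))
          (not_bPrefersGen_Msat σ choice lit (N := N) ⟨_, Msat_literal σ choice hk⟩)
        have happ : signedVote (APrefers (rankI lit) N (Msat σ choice) (Sum.inr (i', k')))
            (APrefers (rankI lit) (Msat σ choice) N (Sum.inr (i', k'))) ≤ 0 := by
          simp [signedVote, APrefers, hab, Msat, hk]
        simp only [applicantPotential, postPotential, hk, if_false]
        linarith
  · intro N _ a ha
    have happ : signedVote (APrefers (rankI lit) N (Msat σ choice) a)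
        (APrefers (rankI lit) (Msat σ choice) N a) ≤ 0 :=
      signedVote_le_zero (by simp [APrefers, ha])
    refine happ.trans ?_
    rcases a with ⟨j, t⟩ | ⟨i, k⟩ <;> simp only [applicantPotential] <;> split_ifs <;> simp
  · intro N _ b hb
    have hN := not_bPrefersGen_of_not_postMatched (prank := prankI) (M := Msat σ choice) hb
    by_cases hM : PostMatched (Msat σ choice) b
    · refine (signedVote_le_neg_one hN (Or.inl ⟨hM, hb⟩)).trans ?_
      rcases b with ⟨j, s⟩ | i | ⟨i, k⟩ <;> simp only [postPotential] <;>
        first | split_ifs <;> simp | simp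
    · refine (signedVote_le_zero hN).trans ?_
      rcases b with ⟨j, s⟩ | i | ⟨i, k⟩
      · exact absurd (postMatched_Msat_variable σ choice j s) hM
      · exact absurd (postMatched_Msat_clause σ choice i) hM
      · have hk : k = choice i := by
          by_contra hk
          exact hM ⟨_, Msat_literal σ choice hk⟩
        simp [postPotential, hk]
end
end
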